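/- arXiv:0903.4102 — 2 statements merged into one kernel-verified Lean document; each statement's English description precedes it below -/
import Mathlib

section
/- Let ε₀, …, ε₉ ∈ ℂ with [x] = e^{iπx} − e^{−iπx}, C = {1,…,6}, ε_{mn} = ε_m − ε_n, ε_{mnp} = ε₀ − ε_m − ε_n − ε_p. Let A₁, …, A₉ ∈ ℂ and B_{ir} ∈ ℂ and B_{ij} = B_{ji} ∈ ℂ be given for i, j ∈ C distinct and r ∈ {7,8,9}. Suppose that for all distinct i, j ∈ C and for r ∈ {8,9}: [ε_{7r}]·A_j·B_{ij} = [ε_{ijr}]·A₇·B_{i7} − [ε_{ij7}]·A_r·B_{ir} (the bilinear equations of type (B)₀), and assume [ε_{ij7}] ≠ 0 for all distinct i, j ∈ C. Then for all distinct i, j ∈ C: [ε_{89}]·A_j·B_{ij} = [ε_{ij9}]·A₈·B_{i8} − [ε_{ij8}]·A₉·B_{i9} (the bilinear equations of type (A)₀). -/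
/-- The trigonometric building block `[t] = e^{iπt} − e^{−iπt} = 2i·sin(πt)`. -/
noncomputable def br (t : ℂ) : ℂ :=
  Complex.exp (Real.pi * Complex.I * t) - Complex.exp (-(Real.pi * Complex.I * t))

/-- The index set `C = {1,…,6}` (points on the conic). -/
def Cset : Set ℕ := {1, 2, 3, 4, 5, 6}

theorem br_sub (a b : ℂ) :
    br (a - b) =
      Complex.exp (Real.pi * Complex.I * a) * Complex.exp (-(Real.pi * Complex.I * b)) -
        Complex.exp (-(Real.pi * Complex.I * a)) * Complex.exp (Real.pi * Complex.I * b) := by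
  rw [br, ← Complex.exp_add, ← Complex.exp_add]
  ring_nf

/-- The three-term relation for `[t]`, the trigonometric case of the Weierstrass relation. -/
theorem br_three_term (s a b c : ℂ) :
    br (a - b) * br (s - c) - br (a - c) * br (s - b) = -(br (s - a) * br (b - c)) := by
  simp only [br_sub]
  ring

/-- The bilinear equations of type (B)₀ imply those of type (A)₀:
here `A m` stands for `τ_{e_m}` and `B m n` for `τ_{e₀−e_m−e_n}`. -/
theorem B0_implies_A0 (ε : ℕ → ℂ) (A : ℕ → ℂ) (B : ℕ → ℕ → ℂ)
    (hBsymm : ∀ i j : ℕ, i ∈ Cset → j ∈ Cset → i ≠ j → B i j = B j i)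
    (hB0 : ∀ i j r : ℕ, i ∈ Cset → j ∈ Cset → i ≠ j → r ∈ ({8, 9} : Set ℕ) →
      br (ε 7 - ε r) * A j * B i j =
        br (ε 0 - ε i - ε j - ε r) * A 7 * B i 7 -
          br (ε 0 - ε i - ε j - ε 7) * A r * B i r)
    (h7 : ∀ i j : ℕ, i ∈ Cset → j ∈ Cset → i ≠ j → br (ε 0 - ε i - ε j - ε 7) ≠ 0) :
    ∀ i j : ℕ, i ∈ Cset → j ∈ Cset → i ≠ j →
      br (ε 8 - ε 9) * A j * B i j =
        br (ε 0 - ε i - ε j - ε 9) * A 8 * B i 8 -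
          br (ε 0 - ε i - ε j - ε 8) * A 9 * B i 9 := by
  intro i j hi hj hij
  have h8 := hB0 i j 8 hi hj hij (by simp)
  have h9 := hB0 i j 9 hi hj hij (by simp)
  have key := br_three_term (ε 0 - ε i - ε j) (ε 7) (ε 8) (ε 9)
  apply mul_left_cancel₀ (h7 i j hi hj hij)
  linear_combination br (ε 0 - ε i - ε j - ε 8) * h9 - br (ε 0 - ε i - ε j - ε 9) * h8 +
    A j * B i j * key
end

section
/- Let L = ℤ¹⁰ with basis e₀, …, e₉ and the symmetric bilinear form ⟨e₀,e₀⟩ = −1, ⟨e_i,e_i⟩ = 1 (1 ≤ i ≤ 9), ⟨e_i,e_j⟩ = 0 (i ≠ j); write e_{ij} = e_i − e_j, e_{ijk} = e₀ − e_i − e_j − e_k, s_v(Λ) = Λ − ⟨v,Λ⟩·v, c = 3e₀ − e₁ − ⋯ − e₉, and T_h(Λ) = Λ + ⟨c,Λ⟩·h − ((⟨h,h⟩/2)·⟨c,Λ⟩ + ⟨h,Λ⟩)·c for ⟨c,h⟩ = 0. Define w_c = s_{e₁−e₂} ∘ s_{e₀−e₁−e₂−e₇} ∘ s_{e₃−e₄}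 ∘ s_{e₀−e₃−e₄−e₇} ∘ s_{e₅−e₆} ∘ s_{e₀−e₅−e₆−e₇}. Then w_c(v) = −v for each of the six vectors v ∈ {e₀−e₁−e₂−e₇, e₁−e₂, e₂−e₃, e₃−e₄, e₄−e₅, e₅−e₆} (so w_c acts as −1 on the D₆ root sublattice they span), w_c(c) = c, and consequently T_h ∘ w_c = w_c ∘ T_h^{−1} for every h in the ℤ-span of these six vectors. -/
/-- The symmetric bilinear form on `L = ℤ¹⁰` with `⟨e₀,e₀⟩ = −1`, `⟨e_i,e_i⟩ = 1`
(`1 ≤ i ≤ 9`) and `⟨e_i,e_j⟩ = 0` (`i ≠ j`). -/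
def form (x y : Fin 10 → ℤ) : ℤ := (∑ i, x i * y i) - 2 * (x 0 * y 0)

/-- The basis vector `e_i`. -/
def ee (i : Fin 10) : Fin 10 → ℤ := fun j => if j = i then 1 else 0

/-- The root `e_{ij} = e_i − e_j`. -/
def eij (i j : Fin 10) : Fin 10 → ℤ := ee i - ee j

/-- The root `e_{ijk} = e₀ − e_i − e_j − e_k`. -/
def eijk (i j k : Fin 10) : Fin 10 → ℤ := ee 0 - ee i - ee j - ee k

/-- The reflection `s_v(Λ) = Λ − ⟨v,Λ⟩·v`. -/
def sRef (v Λ : Fin 10 → ℤ) : Fin 10 → ℤ := Λ - form v Λ • v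

/-- The canonical central element `c = 3e₀ − e₁ − ⋯ − e₉`. -/
def cvec : Fin 10 → ℤ := fun i => if i = 0 then 3 else -1

/-- The translation operator
`T_h(Λ) = Λ + ⟨c,Λ⟩·h − ((⟨h,h⟩/2)·⟨c,Λ⟩ + ⟨h,Λ⟩)·c` for `⟨c,h⟩ = 0`. -/
def T (h Λ : Fin 10 → ℤ) : Fin 10 → ℤ :=
  Λ + form cvec Λ • h - (form h h / 2 * form cvec Λ + form h Λ) • cvec

/-- The central element `w_c = s₁₂ s₁₂₇ s₃₄ s₃₄₇ s₅₆ s₅₆₇` of `W(D₆)`. -/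
def wc (Λ : Fin 10 → ℤ) : Fin 10 → ℤ :=
  sRef (eij 1 2) (sRef (eijk 1 2 7) (sRef (eij 3 4) (sRef (eijk 3 4 7)
    (sRef (eij 5 6) (sRef (eijk 5 6 7) Λ)))))

/-- The simple roots of the `D₆` subsystem. -/
def D6roots : Set (Fin 10 → ℤ) :=
  {eijk 1 2 7, eij 1 2, eij 2 3, eij 3 4, eij 4 5, eij 5 6}

lemma form_comm (x y : Fin 10 → ℤ) : form x y = form y x := by
  simp only [form, mul_comm]

lemma form_add_right (x y z : Fin 10 → ℤ) : form x (y + z) = form x y + form x z := by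
  simp only [form, Pi.add_apply, mul_add, Finset.sum_add_distrib]
  ring

lemma form_smul_right (a : ℤ) (x y : Fin 10 → ℤ) : form x (a • y) = a * form x y := by
  simp only [form, Pi.smul_apply, smul_eq_mul, mul_left_comm _ a, ← Finset.mul_sum]
  ring

lemma form_neg_right (x y : Fin 10 → ℤ) : form x (-y) = -form x y := by
  simpa using form_smul_right (-1) x y

lemma form_neg_left (x y : Fin 10 → ℤ) : form (-x) y = -form x y := by
  rw [form_comm, form_neg_right, form_comm]

lemma form_sub_right (x y z : Fin 10 → ℤ) : form x (y - z) = form x y - form x z := by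
  rw [sub_eq_add_neg, form_add_right, form_neg_right, sub_eq_add_neg]

lemma sRef_add (v x y : Fin 10 → ℤ) : sRef v (x + y) = sRef v x + sRef v y := by
  simp only [sRef, form_add_right]
  module

lemma sRef_smul (v : Fin 10 → ℤ) (a : ℤ) (x : Fin 10 → ℤ) :
    sRef v (a • x) = a • sRef v x := by
  simp only [sRef, form_smul_right]
  module

lemma form_sRef_sRef {v : Fin 10 → ℤ} (hv : form v v = 2) (x y : Fin 10 → ℤ) :
    form (sRef v x) (sRef v y) = form x y := by
  simp only [sRef]
  rw [form_sub_right, form_smul_right, form_comm _ y, form_comm _ v]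
  simp only [form_sub_right, form_smul_right, form_comm y x, form_comm y v, hv]
  ring

lemma wc_add (x y : Fin 10 → ℤ) : wc (x + y) = wc x + wc y := by
  simp only [wc, sRef_add]

lemma wc_smul (a : ℤ) (x : Fin 10 → ℤ) : wc (a • x) = a • wc x := by
  simp only [wc, sRef_smul]

lemma wc_sub (x y : Fin 10 → ℤ) : wc (x - y) = wc x - wc y := by
  have h := wc_add x ((-1 : ℤ) • y)
  rw [wc_smul] at h
  simpa [sub_eq_add_neg] using h

lemma form_wc_wc (x y : Fin 10 → ℤ) : form (wc x) (wc y) = form x y := by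
  unfold wc
  iterate 6 rw [form_sRef_sRef (by decide)]

lemma wc_cvec : wc cvec = cvec := by
  decide

lemma wc_of_mem_D6roots {v : Fin 10 → ℤ} (hv : v ∈ D6roots) : wc v = -v := by
  simp only [D6roots, Set.mem_insert_iff, Set.mem_singleton_iff] at hv
  rcases hv with rfl | rfl | rfl | rfl | rfl | rfl <;> decide

lemma wc_of_mem_span {h : Fin 10 → ℤ} (hh : h ∈ Submodule.span ℤ D6roots) : wc h = -h := by
  induction hh using Submodule.span_induction with
  | mem v hv => exact wc_of_mem_D6roots hv
  | zero => simpa using wc_smul 0 0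
  | add x y _ _ hx hy => rw [wc_add, hx, hy, neg_add]
  | smul a x _ hx => rw [wc_smul, hx, smul_neg]

/-- The central element `w_c` of `W(D₆)` acts as `−1` on the `D₆` root sublattice,
fixes `c`, and satisfies `T_h ∘ w_c = w_c ∘ T_h⁻¹ (= w_c ∘ T_{−h})` for every `h`
in the span of the `D₆` simple roots. -/
theorem wc_properties :
    (∀ v ∈ D6roots, wc v = -v) ∧
    wc cvec = cvec ∧
    (∀ h ∈ Submodule.span ℤ D6roots, ∀ Λ : Fin 10 → ℤ,
      T h (wc Λ) = wc (T (-h) Λ)) := by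
  refine ⟨fun v hv => wc_of_mem_D6roots hv, wc_cvec, fun h hh Λ => ?_⟩
  have hw := wc_of_mem_span hh
  have hc : form cvec (wc Λ) = form cvec Λ := by
    simpa only [wc_cvec] using form_wc_wc cvec Λ
  have hf : form h (wc Λ) = -form h Λ := by
    rw [← form_wc_wc h Λ, hw, form_neg_left, neg_neg]
  have hn : wc (-h) = h := by
    simpa [hw] using wc_smul (-1) h
  simp only [T, wc_sub, wc_add, wc_smul, wc_cvec, hn, hc, hf, form_neg_left, form_neg_right,
    neg_neg]
end
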